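/- Let a > −1 and b > 0 be real numbers and set c = b/(8(1+a)). Then ∫₀^∞ sin(b·x²/(x⁴+2a·x²+1)) dx = (π·b / √(8(1+a))) · [J₀(2c)·cos(2c) + J₁(2c)·sin(2c)]. -/

import Mathlib

open MeasureTheory

/-- The Bessel function of the first kind `J₀`, defined by its
everywhere-convergent power series. -/
noncomputable def besselJ0 (z : ℝ) : ℝ :=
  ∑' k : ℕ, (-1 : ℝ) ^ k * (z / 2) ^ (2 * k) / ((Nat.factorial k : ℝ)) ^ 2

/-- The Bessel function of the first kind `J₁`, defined by its
everywhere-convergent power series. -/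
noncomputable def besselJ1 (z : ℝ) : ℝ :=
  ∑' k : ℕ, (-1 : ℝ) ^ k * (z / 2) ^ (2 * k + 1) /
    ((Nat.factorial k : ℝ) * (Nat.factorial (k + 1) : ℝ))


open Polynomial in
lemma coeff_X_sq_add_one_pow (j n : ℕ) :
    ((X ^ 2 + 1 : ℕ[X]) ^ j).coeff n = if 2 ∣ n then j.choose (n / 2) else 0 := by
  have h : (X ^ 2 + 1 : ℕ[X]) ^ j = expand ℕ 2 ((X + 1) ^ j) := by simp
  rw [h, coeff_expand two_pos, coeff_X_add_one_pow]
  simp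

open Polynomial in
lemma sum_choose_mul_coeff (m r : ℕ) :
    ∑ j ∈ Finset.range (m + 1), m.choose j * 2 ^ (m - j) *
      (if m - j ≤ r then ((X ^ 2 + 1 : ℕ[X]) ^ j).coeff (r - (m - j)) else 0) =
      (2 * m).choose r := by
  have h : ((X + 1 : ℕ[X]) ^ (2 * m)) = (X ^ 2 + 1 + 2 * X) ^ m := by
    rw [pow_mul]; ring
  have h2 := coeff_X_add_one_pow ℕ (2 * m) r
  rw [h, add_pow, finsetSum_coeff] at h2
  rw [Nat.cast_id] at h2
  rw [← h2]
  refine Finset.sum_congr rfl fun j _ => ?_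
  have : (X ^ 2 + 1 : ℕ[X]) ^ j * (2 * X) ^ (m - j) * (m.choose j : ℕ[X]) =
      C (m.choose j * 2 ^ (m - j)) * ((X ^ 2 + 1 : ℕ[X]) ^ j * X ^ (m - j)) := by
    have hC : (C (m.choose j) : ℕ[X]) = (m.choose j : ℕ[X]) := by simp
    rw [map_mul, hC, map_pow, map_ofNat, mul_pow]
    ring
  rw [this, coeff_C_mul, coeff_mul_X_pow']

lemma Finset.sum_range_two_mul {M : Type*} [AddCommMonoid M] (f : ℕ → M) (n : ℕ) :
    ∑ j ∈ range (2 * n), f j = ∑ k ∈ range n, (f (2 * k) + f (2 * k + 1)) := by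
  induction n with
  | zero => simp
  | succ n ih => rw [mul_add, mul_one, sum_range_succ, sum_range_succ, sum_range_succ, ih, add_assoc]

lemma sum_choose_even_mul_centralBinom (n : ℕ) :
    ∑ k ∈ Finset.range (n + 1), (2 * n).choose (2 * k) * 2 ^ (2 * (n - k)) * (2 * k).choose k =
      (4 * n).choose (2 * n) := by
  have h := sum_choose_mul_coeff (2 * n) (2 * n)
  rw [← mul_assoc] at h
  norm_num only at h
  rw [← h, Finset.sum_range_succ, Finset.sum_range_succ _ (2 * n), Finset.sum_range_two_mul]
  congr 1
  · refine Finset.sum_congr rfl fun k hk => ?_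
    have hk := Finset.mem_range.1 hk
    rw [if_pos (by omega), if_pos (by omega), coeff_X_sq_add_one_pow, coeff_X_sq_add_one_pow,
      if_pos (by omega), if_neg (by omega), mul_zero, add_zero]
    congr 2 <;> first | omega | (congr 1; omega)
  · rw [if_pos (by omega), coeff_X_sq_add_one_pow, if_pos (by omega)]
    congr 2 <;> first | omega | (congr 1; omega)

lemma sum_choose_odd_mul_choose (n : ℕ) :
    ∑ k ∈ Finset.range (n + 1),
      (2 * n + 2).choose (2 * k + 1) * 2 ^ (2 * (n - k) + 1) * (2 * k + 1).choose k =
      (4 * n + 4).choose (2 * n + 1) := by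
  have h := sum_choose_mul_coeff (2 * n + 2) (2 * n + 1)
  rw [show 2 * (2 * n + 2) = 4 * n + 4 by ring] at h
  rw [← h, Finset.sum_range_succ _ (2 * n + 2), show 2 * n + 2 = 2 * (n + 1) by ring, Finset.sum_range_two_mul,
    if_pos (by omega), coeff_X_sq_add_one_pow, if_neg (by omega), mul_zero, add_zero]
  refine Finset.sum_congr rfl fun k hk => ?_
  have hk := Finset.mem_range.1 hk
  have h0 : (if 2 * (n + 1) - 2 * k ≤ 2 * n + 1 then
      ((Polynomial.X ^ 2 + 1 : Polynomial ℕ) ^ (2 * k)).coeff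
        (2 * n + 1 - (2 * (n + 1) - 2 * k)) else 0) = 0 := by
    split_ifs with h
    · rw [coeff_X_sq_add_one_pow, if_neg (by omega)]
    · rfl
  rw [h0, mul_zero, zero_add, if_pos (by omega), coeff_X_sq_add_one_pow, if_pos (by omega)]
  congr 2 <;> first | omega | (congr 1; omega)

lemma summable_besselJ0 (z : ℝ) :
    Summable fun k : ℕ => (-1 : ℝ) ^ k * (z / 2) ^ (2 * k) / ((Nat.factorial k : ℝ)) ^ 2 := by
  refine (Real.summable_pow_div_factorial ((z / 2) ^ 2)).of_norm_bounded fun k => ?_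
  have h1 : (1 : ℝ) ≤ k.factorial := by exact_mod_cast k.factorial_pos
  rw [norm_div, norm_mul, norm_pow, norm_neg, norm_one, one_pow, one_mul, pow_mul,
    Real.norm_of_nonneg (by positivity), Real.norm_of_nonneg (by positivity)]
  gcongr
  nlinarith

lemma summable_besselJ1 (z : ℝ) :
    Summable fun k : ℕ => (-1 : ℝ) ^ k * (z / 2) ^ (2 * k + 1) /
      ((Nat.factorial k : ℝ) * (Nat.factorial (k + 1) : ℝ)) := by
  refine ((Real.summable_pow_div_factorial ((z / 2) ^ 2)).mul_left |z / 2|).of_norm_bounded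
    fun k => ?_
  have h1 : (1 : ℝ) ≤ (k + 1).factorial := by exact_mod_cast (k + 1).factorial_pos
  have h2 : (0 : ℝ) < k.factorial := by exact_mod_cast k.factorial_pos
  rw [norm_div, norm_mul, norm_pow, norm_neg, norm_one, one_pow, one_mul, pow_succ, pow_mul,
    norm_mul, Real.norm_of_nonneg (by positivity : 0 ≤ ((z / 2) ^ 2) ^ k),
    Real.norm_of_nonneg (by positivity : (0 : ℝ) ≤ k.factorial * (k + 1).factorial),
    Real.norm_eq_abs, mul_comm, mul_div_assoc]
  gcongr
  nlinarith

lemma hasSum_besselJ0_mul_cos (z : ℝ) :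
    HasSum (fun n : ℕ => (-1 : ℝ) ^ n * z ^ (2 * n) * (4 * n).choose (2 * n) /
      (4 ^ n * (2 * n).factorial)) (besselJ0 z * Real.cos z) := by
  have h := hasSum_sum_range_mul_of_summable_norm (summable_besselJ0 z).norm
    (Real.hasSum_cos z).summable.norm
  rw [(Real.hasSum_cos z).tsum_eq] at h
  convert! h using 1
  ext n
  rw [← sum_choose_even_mul_centralBinom]
  push_cast
  rw [Finset.mul_sum, Finset.sum_div]
  refine Finset.sum_congr rfl fun k hk => ?_
  obtain ⟨l, rfl⟩ := Nat.exists_eq_add_of_le (Nat.lt_succ_iff.1 (Finset.mem_range.1 hk))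
  rw [Nat.add_sub_cancel_left, show 2 * (k + l) = 2 * k + 2 * l by ring, Nat.cast_add_choose,
    show (2 * k).choose k = (k + k).choose k by rw [two_mul], Nat.cast_add_choose,
    show (k + k).factorial = (2 * k).factorial by rw [two_mul], div_pow, pow_mul 2 2 k,
    pow_mul 2 2 l, pow_add 4, pow_add z, pow_add (-1)]
  norm_num only
  field_simp

lemma hasSum_besselJ1_mul_sin (z : ℝ) :
    HasSum (fun n : ℕ => (-1 : ℝ) ^ n * z ^ (2 * n + 2) * (4 * n + 4).choose (2 * n + 1) /
      (4 ^ (n + 1) * (2 * n + 2).factorial)) (besselJ1 z * Real.sin z) := by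
  have h := hasSum_sum_range_mul_of_summable_norm (summable_besselJ1 z).norm
    (Real.hasSum_sin z).summable.norm
  rw [(Real.hasSum_sin z).tsum_eq] at h
  convert! h using 1
  ext n
  rw [← sum_choose_odd_mul_choose]
  push_cast
  rw [Finset.mul_sum, Finset.sum_div]
  refine Finset.sum_congr rfl fun k hk => ?_
  obtain ⟨l, rfl⟩ := Nat.exists_eq_add_of_le (Nat.lt_succ_iff.1 (Finset.mem_range.1 hk))
  rw [Nat.add_sub_cancel_left, show 2 * (k + l) + 2 = (2 * k + 1) + (2 * l + 1) by ring,
    Nat.cast_add_choose, show (2 * k + 1).choose k = (k + (k + 1)).choose k by congr 1; ring,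
    Nat.cast_add_choose, show (k + (k + 1)).factorial = (2 * k + 1).factorial by congr 1; ring,
    div_pow, pow_succ 2 (2 * k), pow_succ 2 (2 * l), pow_mul 2 2 k,
    pow_mul 2 2 l, pow_succ 4, pow_add 4, pow_add z, pow_add (-1)]
  norm_num only
  field_simp
  ring

lemma hasSum_besselJ0_mul_cos_add_besselJ1_mul_sin (z : ℝ) :
    HasSum (fun n : ℕ => (-1 : ℝ) ^ n * z ^ (2 * n) * (2 * n).centralBinom /
      (4 ^ n * (2 * n + 1).factorial))
      (besselJ0 z * Real.cos z + besselJ1 z * Real.sin z) := by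
  have hA := hasSum_besselJ0_mul_cos z
  have hB := hasSum_besselJ1_mul_sin z
  rw [← hasSum_nat_add_iff' 1] at hA ⊢
  convert! hA.add hB using 1
  · ext n
    have h1 : ((4 * n + 4).choose (2 * n + 2) : ℝ) * (2 * n + 2) =
        (4 * n + 4).choose (2 * n + 1) * (2 * n + 3) := by
      have := Nat.choose_succ_right_eq (4 * n + 4) (2 * n + 1)
      rw [show 4 * n + 4 - (2 * n + 1) = 2 * n + 3 by omega] at this
      exact_mod_cast this
    rw [Nat.centralBinom_eq_two_mul_choose, show 2 * (2 * (n + 1)) = 4 * n + 4 by ring,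
      show 4 * (n + 1) = 4 * n + 4 by ring, show 2 * (n + 1) = 2 * n + 2 by ring,
      Nat.factorial_succ (2 * n + 2), pow_succ (-1)]
    push_cast
    field_simp
    linear_combination z ^ (2 * n + 2) * h1
  · simp
    ring

open Filter Topology

lemma integrable_inv_one_add_sq_pow (m : ℕ) :
    Integrable fun t : ℝ => ((1 + t ^ 2)⁻¹) ^ (m + 1) := by
  refine integrable_inv_one_add_sq.mono' (by fun_prop) (Eventually.of_forall fun t => ?_)
  have h : (1 + t ^ 2)⁻¹ ≤ 1 := inv_le_one_of_one_le₀ (by nlinarith [sq_nonneg t])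
  rw [Real.norm_of_nonneg (by positivity)]
  exact pow_le_of_le_one (by positivity) h (by omega)

lemma abs_mul_inv_one_add_sq_pow_le (m : ℕ) (t : ℝ) :
    |t * ((1 + t ^ 2)⁻¹) ^ (m + 1)| ≤ |t|⁻¹ := by
  have h : (1 + t ^ 2)⁻¹ ≤ 1 := inv_le_one_of_one_le₀ (by nlinarith [sq_nonneg t])
  have h' : ((1 + t ^ 2)⁻¹) ^ (m + 1) ≤ (1 + t ^ 2)⁻¹ :=
    pow_le_of_le_one (by positivity) h (by omega)
  rcases eq_or_ne t 0 with rfl | ht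
  · simp
  have ht' : 0 < |t| := abs_pos.2 ht
  rw [abs_mul, abs_of_nonneg (by positivity : 0 ≤ ((1 + t ^ 2)⁻¹) ^ (m + 1))]
  calc |t| * ((1 + t ^ 2)⁻¹) ^ (m + 1) ≤ |t| * (1 + t ^ 2)⁻¹ := by gcongr
    _ ≤ |t|⁻¹ := by
      rw [← div_eq_mul_inv, inv_eq_one_div, div_le_div_iff₀ (by positivity) ht']
      nlinarith [sq_abs t]

lemma integral_inv_one_add_sq_pow_succ (m : ℕ) :
    2 * (m + 1 : ℝ) * ∫ t : ℝ, ((1 + t ^ 2)⁻¹) ^ (m + 2) =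
      (2 * m + 1) * ∫ t : ℝ, ((1 + t ^ 2)⁻¹) ^ (m + 1) := by
  have hd (t : ℝ) : HasDerivAt (fun t : ℝ => t * ((1 + t ^ 2)⁻¹) ^ (m + 1))
      (2 * (m + 1 : ℝ) * ((1 + t ^ 2)⁻¹) ^ (m + 2) -
        (2 * m + 1) * ((1 + t ^ 2)⁻¹) ^ (m + 1)) t := by
    have h0 : 1 + t ^ 2 ≠ 0 := by positivity
    have h1 : HasDerivAt (fun t : ℝ => 1 + t ^ 2) (2 * t) t := by
      simpa using (hasDerivAt_pow 2 t).const_add 1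
    have h2 := (hasDerivAt_id t).mul ((h1.inv h0).pow (m + 1))
    convert! h2 using 1
    simp only [id, Pi.pow_apply, Pi.inv_apply, Nat.add_sub_cancel, Nat.cast_add, Nat.cast_one]
    rw [show m + 2 = m + 1 + 1 by rfl, pow_succ _ (m + 1), pow_succ _ m]
    generalize ((1 + t ^ 2)⁻¹) ^ m = p
    field_simp
    ring
  have hA := integrable_inv_one_add_sq_pow m
  have hB := integrable_inv_one_add_sq_pow (m + 1)
  have hbot : Tendsto (fun t : ℝ => t * ((1 + t ^ 2)⁻¹) ^ (m + 1)) atBot (𝓝 0) :=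
    squeeze_zero_norm (abs_mul_inv_one_add_sq_pow_le m)
      (tendsto_inv_atTop_zero.comp tendsto_abs_atBot_atTop)
  have htop : Tendsto (fun t : ℝ => t * ((1 + t ^ 2)⁻¹) ^ (m + 1)) atTop (𝓝 0) :=
    squeeze_zero_norm (abs_mul_inv_one_add_sq_pow_le m)
      (tendsto_inv_atTop_zero.comp tendsto_abs_atTop_atTop)
  have h := integral_of_hasDerivAt_of_tendsto hd ((hB.const_mul _).sub (hA.const_mul _)) hbot htop
  rw [integral_sub (hB.const_mul _) (hA.const_mul _), integral_const_mul, integral_const_mul] at h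
  linarith

lemma integral_inv_one_add_sq_pow (m : ℕ) :
    ∫ t : ℝ, ((1 + t ^ 2)⁻¹) ^ (m + 1) = Real.pi * m.centralBinom / 4 ^ m := by
  induction m with
  | zero => simp
  | succ m ih =>
    have h := integral_inv_one_add_sq_pow_succ m
    have hc : ((m : ℝ) + 1) * (m + 1).centralBinom = 2 * (2 * m + 1) * m.centralBinom := by
      exact_mod_cast Nat.succ_mul_centralBinom_succ m
    rw [ih] at h
    have hm : (m + 1 : ℝ) ≠ 0 := by positivity
    apply mul_left_cancel₀ (mul_ne_zero two_ne_zero hm)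
    rw [h, pow_succ]
    field_simp
    linear_combination (-2) * hc

lemma integrable_sin_div_one_add_sq (w : ℝ) :
    Integrable fun t : ℝ => Real.sin (w * (1 + t ^ 2)⁻¹) := by
  refine (integrable_inv_one_add_sq.const_mul |w|).mono' (by fun_prop)
    (Eventually.of_forall fun t => ?_)
  refine Real.abs_sin_le_abs.trans ?_
  rw [abs_mul, abs_of_nonneg (by positivity : 0 ≤ (1 + t ^ 2)⁻¹)]

lemma hasSum_integral_sin_div_one_add_sq (w : ℝ) :
    HasSum (fun n : ℕ => (-1 : ℝ) ^ n * w ^ (2 * n + 1) / (2 * n + 1).factorial *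
      (Real.pi * (2 * n).centralBinom / 4 ^ (2 * n)))
      (∫ t : ℝ, Real.sin (w * (1 + t ^ 2)⁻¹)) := by
  have hI (n : ℕ) := (integrable_inv_one_add_sq_pow (2 * n)).const_mul
    ((-1 : ℝ) ^ n * w ^ (2 * n + 1) / (2 * n + 1).factorial)
  have hs : Summable fun n : ℕ => |w| ^ (2 * n + 1) / (2 * n + 1).factorial * Real.pi :=
    ((Real.summable_pow_div_factorial |w|).comp_injective
      (i := fun n : ℕ => 2 * n + 1) (fun a b h => by simpa using h)).mul_right _
  have hle (n : ℕ) : ∫ t : ℝ, ((1 + t ^ 2)⁻¹) ^ (2 * n + 1) ≤ Real.pi := by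
    rw [← integral_univ_inv_one_add_sq]
    refine integral_mono (integrable_inv_one_add_sq_pow _) integrable_inv_one_add_sq fun t => ?_
    exact pow_le_of_le_one (by positivity)
      (inv_le_one_of_one_le₀ (by nlinarith [sq_nonneg t])) (by omega)
  have h := hasSum_integral_of_summable_integral_norm hI ?_
  · convert! h using 1
    · ext n
      rw [integral_const_mul, integral_inv_one_add_sq_pow]
    · congr 1
      ext t
      rw [← (Real.hasSum_sin _).tsum_eq]
      congr 1
      ext n
      rw [mul_pow]
      ring
  · refine hs.of_nonneg_of_le (fun n => integral_nonneg fun t => norm_nonneg _) fun n => ?_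
    have (t : ℝ) : ‖(-1 : ℝ) ^ n * w ^ (2 * n + 1) / (2 * n + 1).factorial *
        ((1 + t ^ 2)⁻¹) ^ (2 * n + 1)‖ =
        |w| ^ (2 * n + 1) / (2 * n + 1).factorial * ((1 + t ^ 2)⁻¹) ^ (2 * n + 1) := by
      rw [norm_mul, Real.norm_of_nonneg (by positivity : 0 ≤ ((1 + t ^ 2)⁻¹) ^ (2 * n + 1))]
      simp
    simp_rw [this]
    rw [integral_const_mul]
    gcongr
    exact hle n

lemma hasDerivAt_sub_inv {x : ℝ} (hx : x ≠ 0) :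
    HasDerivAt (fun x : ℝ => x - x⁻¹) (1 + (x ^ 2)⁻¹) x := by
  convert! (hasDerivAt_id x).sub (hasDerivAt_inv hx) using 1
  ring

lemma image_sub_inv_Ioi : (fun x : ℝ => x - x⁻¹) '' Set.Ioi 0 = Set.univ := by
  refine Set.eq_univ_of_forall fun u => ⟨(u + √(u ^ 2 + 4)) / 2, ?_, ?_⟩ <;>
  have hs : √(u ^ 2 + 4) ^ 2 = u ^ 2 + 4 := Real.sq_sqrt (by positivity) <;>
  have hp : 0 < u + √(u ^ 2 + 4) := by
    have : |u| < √(u ^ 2 + 4) := Real.lt_sqrt_of_sq_lt (by rw [sq_abs]; linarith)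
    linarith [neg_abs_le u]
  · exact half_pos hp
  · simp only
    field_simp
    nlinarith

lemma injOn_sub_inv_Ioi : Set.InjOn (fun x : ℝ => x - x⁻¹) (Set.Ioi 0) := by
  refine StrictMonoOn.injOn fun x hx y hy hxy => ?_
  have := inv_strictAnti₀ hx hxy
  exact sub_lt_sub hxy this

lemma integral_Ioi_comp_inv (g : ℝ → ℝ) :
    ∫ x in Set.Ioi (0 : ℝ), (x ^ 2)⁻¹ * g x⁻¹ = ∫ x in Set.Ioi (0 : ℝ), g x := by
  rw [← integral_comp_rpow_Ioi g (p := -1) (by norm_num)]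
  refine setIntegral_congr_fun measurableSet_Ioi fun x hx => ?_
  have hx : (0 : ℝ) < x := hx
  simp only [Real.rpow_neg_one, smul_eq_mul, abs_neg, abs_one, one_mul]
  rw [show (-1 - 1 : ℝ) = -(2 : ℕ) by norm_num, Real.rpow_neg hx.le, Real.rpow_natCast]

/-- The Cauchy–Schlömilch transformation. -/
lemma integral_Ioi_comp_sub_inv {F : ℝ → ℝ} (hF : Integrable F) (heven : ∀ x, F (-x) = F x) :
    2 * ∫ x in Set.Ioi (0 : ℝ), F (x - x⁻¹) = ∫ x, F x := by
  have hd : ∀ x ∈ Set.Ioi (0 : ℝ), HasDerivWithinAt (fun x : ℝ => x - x⁻¹) (1 + (x ^ 2)⁻¹)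
      (Set.Ioi 0) x := fun x hx => (hasDerivAt_sub_inv (ne_of_gt hx)).hasDerivWithinAt
  have hint := (integrableOn_image_iff_integrableOn_abs_deriv_smul measurableSet_Ioi hd
    injOn_sub_inv_Ioi F).1 hF.integrableOn
  have heq := integral_image_eq_integral_abs_deriv_smul measurableSet_Ioi hd injOn_sub_inv_Ioi F
  have habs (x : ℝ) : |1 + (x ^ 2)⁻¹| = 1 + (x ^ 2)⁻¹ := abs_of_pos (by positivity)
  simp only [habs, smul_eq_mul] at hint heq
  rw [image_sub_inv_Ioi, setIntegral_univ] at heq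
  have h1 : IntegrableOn (fun x : ℝ => F (x - x⁻¹)) (Set.Ioi 0) := by
    have hb := Integrable.bdd_mul (f := fun x : ℝ => (1 + (x ^ 2)⁻¹)⁻¹) (c := 1) hint
      (by fun_prop) (Eventually.of_forall fun x => ?_)
    · refine hb.congr (Eventually.of_forall fun x => ?_)
      have : (1 + (x ^ 2)⁻¹) ≠ 0 := by positivity
      simp only
      rw [inv_mul_cancel_left₀ this]
    · rw [Real.norm_of_nonneg (by positivity)]
      exact inv_le_one_of_one_le₀ (by have : 0 ≤ (x ^ 2)⁻¹ := by positivity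
                                      linarith)
  have h2 : IntegrableOn (fun x : ℝ => (x ^ 2)⁻¹ * F (x - x⁻¹)) (Set.Ioi 0) := by
    refine (hint.sub h1).congr (Eventually.of_forall fun x => ?_)
    simp only [Pi.sub_apply]
    ring
  have h3 : ∫ x in Set.Ioi (0 : ℝ), (x ^ 2)⁻¹ * F (x - x⁻¹) =
      ∫ x in Set.Ioi (0 : ℝ), F (x - x⁻¹) := by
    rw [← integral_Ioi_comp_inv (fun x => F (x - x⁻¹))]
    refine setIntegral_congr_fun measurableSet_Ioi fun x _ => ?_
    simp only [inv_inv]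
    rw [← heven (x⁻¹ - x), neg_sub]
  rw [heq]
  simp_rw [add_mul, one_mul]
  rw [integral_add h1 h2, h3, two_mul]

theorem integral_sin_rational_eq_bessel (a b : ℝ) (ha : -1 < a) (hb : 0 < b)
    (c : ℝ) (hc : c = b / (8 * (1 + a))) :
    ∫ x in Set.Ioi (0 : ℝ), Real.sin (b * x ^ 2 / (x ^ 4 + 2 * a * x ^ 2 + 1)) =
      Real.pi * b / Real.sqrt (8 * (1 + a)) *
        (besselJ0 (2 * c) * Real.cos (2 * c) + besselJ1 (2 * c) * Real.sin (2 * c)) := by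
  have hk : 0 < 2 * (1 + a) := by linarith
  obtain ⟨k, hk'⟩ : ∃ k, k = 2 * (1 + a) := ⟨_, rfl⟩
  rw [← hk'] at hk
  have hs : √k ^ 2 = k := Real.sq_sqrt hk.le
  have hs0 : 0 < √k := Real.sqrt_pos.2 hk
  have hF : Integrable fun u : ℝ => Real.sin (b / k * (1 + (u / √k) ^ 2)⁻¹) :=
    (integrable_sin_div_one_add_sq (b / k)).comp_div hs0.ne'
  have hchange := integral_Ioi_comp_sub_inv hF (fun u => by rw [neg_div, neg_sq])
  rw [Measure.integral_comp_div (fun t => Real.sin (b / k * (1 + t ^ 2)⁻¹)), abs_of_pos hs0,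
    smul_eq_mul] at hchange
  have hcongr : ∫ x in Set.Ioi (0 : ℝ), Real.sin (b * x ^ 2 / (x ^ 4 + 2 * a * x ^ 2 + 1)) =
      ∫ x in Set.Ioi (0 : ℝ), Real.sin (b / k * (1 + ((x - x⁻¹) / √k) ^ 2)⁻¹) := by
    refine setIntegral_congr_fun measurableSet_Ioi fun x hx => ?_
    have hx : 0 < x := hx
    have ha' : 2 * a = k - 2 := by linarith
    have h1 : x ^ 4 + (k - 2) * x ^ 2 + 1 = (x ^ 2 - 1) ^ 2 + k * x ^ 2 := by ring
    have h2 : 0 < (x ^ 2 - 1) ^ 2 + k * x ^ 2 := by positivity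
    have h3 : (1 + ((x - x⁻¹) / √k) ^ 2) = ((x ^ 2 - 1) ^ 2 + k * x ^ 2) / (k * x ^ 2) := by
      rw [div_pow, hs]
      field_simp
      ring
    rw [ha', h1, h3, inv_div]
    congr 1
    field_simp
  have hbk : b / k = 2 * (2 * c) := by
    rw [hc, hk']
    have : 1 + a ≠ 0 := by linarith
    field_simp
    norm_num
  have hval : ∫ t : ℝ, Real.sin (b / k * (1 + t ^ 2)⁻¹) = Real.pi * (b / k) *
      (besselJ0 (2 * c) * Real.cos (2 * c) + besselJ1 (2 * c) * Real.sin (2 * c)) := by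
    refine (hasSum_integral_sin_div_one_add_sq (b / k)).unique ?_
    convert! (hasSum_besselJ0_mul_cos_add_besselJ1_mul_sin (2 * c)).mul_left
      (Real.pi * (b / k)) using 1
    ext n
    rw [hbk, pow_succ, mul_pow, pow_mul 4 2 n, pow_mul 2 2 n,
      show (4 : ℝ) ^ 2 = 4 * 4 by norm_num, mul_pow (4 : ℝ) 4 n]
    norm_num only
    field_simp
  have hsqrt : √(8 * (1 + a)) = 2 * √k := by
    rw [show 8 * (1 + a) = 2 ^ 2 * k by linarith, Real.sqrt_mul (by norm_num),
      Real.sqrt_sq (by norm_num)]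
  rw [hval] at hchange
  rw [hcongr, hsqrt]
  apply mul_left_cancel₀ (two_ne_zero (α := ℝ))
  rw [hchange]
  nth_rewrite 2 [← hs]
  field_simp
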